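/- Soundness direction of the criterion for continuous invariants (Theorem 2): Let f be a polynomial vector field on ℝⁿ whose solutions exist and are unique on [0, ∞), and let p, h ∈ ℝ[x1, …, xn] be polynomials. Suppose that for every x ∈ ℝⁿ with p(x) = 0 and h(x) > 0, either L^k_f p(x) = 0 for all k ≥ 1, or the least k ≥ 1 with L^k_f p(x) ≠ 0 satisfies L^k_f p(x) > 0. Then the set P = {x ∈ ℝⁿ : p(x) ≥ 0} is a continuous invariant of (D, f), where D = {x ∈ ℝⁿ : h(x) > 0}. -/

import Mathlib

open MvPolynomial Set

/-- Lie derivatives of a polynomial `p` along the polynomial vector field `f`. -/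
noncomputable def lieDeriv {n : ℕ} (f : Fin n → MvPolynomial (Fin n) ℝ)
    (p : MvPolynomial (Fin n) ℝ) : ℕ → MvPolynomial (Fin n) ℝ
  | 0 => p
  | k + 1 => ∑ i, (pderiv i (lieDeriv f p k)) * f i

/-- Evaluation of a polynomial vector field at a point of ℝⁿ. -/
noncomputable def evalVF {n : ℕ} (f : Fin n → MvPolynomial (Fin n) ℝ)
    (x : Fin n → ℝ) : Fin n → ℝ := fun i => eval x (f i)

/-- `x : ℝ → ℝⁿ` is a solution of `ẋ = F(x)` on `[0, ∞)`. -/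
def IsSolutionOn {n : ℕ} (F : (Fin n → ℝ) → (Fin n → ℝ)) (x : ℝ → (Fin n → ℝ)) : Prop :=
  ∀ t ∈ Ici (0:ℝ), HasDerivWithinAt x (F (x t)) (Ici 0) t

/-- Solutions of `ẋ = F(x)` exist and are unique on `[0, ∞)` for every initial condition. -/
def CompleteFlow {n : ℕ} (F : (Fin n → ℝ) → (Fin n → ℝ)) : Prop :=
  (∀ x0 : Fin n → ℝ, ∃ x : ℝ → (Fin n → ℝ), x 0 = x0 ∧ IsSolutionOn F x) ∧
  (∀ x y : ℝ → (Fin n → ℝ), IsSolutionOn F x → IsSolutionOn F y → x 0 = y 0 →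
    ∀ t ∈ Ici (0:ℝ), x t = y t)

/-- `P` is a continuous invariant of `(D, F)`. -/
def IsCI {n : ℕ} (D P : Set (Fin n → ℝ)) (F : (Fin n → ℝ) → (Fin n → ℝ)) : Prop :=
  ∀ x : ℝ → (Fin n → ℝ), IsSolutionOn F x → x 0 ∈ P ∩ D →
    ∀ T ≥ (0:ℝ), (∀ t ∈ Icc (0:ℝ) T, x t ∈ D) → ∀ t ∈ Icc (0:ℝ) T, x t ∈ P

/-- Along a solution, the derivative of a polynomial is its Lie derivative. -/
theorem IsSolutionOn.hasDerivWithinAt_eval {n : ℕ} {f : Fin n → MvPolynomial (Fin n) ℝ}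
    {x : ℝ → (Fin n → ℝ)} (hx : IsSolutionOn (evalVF f) x) (q : MvPolynomial (Fin n) ℝ)
    {t : ℝ} (ht : 0 ≤ t) :
    HasDerivWithinAt (fun s => eval (x s) q) (eval (x t) (∑ i, pderiv i q * f i)) (Ici 0) t := by
  induction q using MvPolynomial.induction_on with
  | C a => simpa using hasDerivWithinAt_const t (Ici (0 : ℝ)) a
  | add p q hp hq =>
    simp only [map_add, add_mul, Finset.sum_add_distrib]
    exact hp.add hq
  | mul_X p i hp =>
    have hi := hasDerivWithinAt_pi.1 (hx t ht) i
    have hmul := hp.mul hi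
    have key : eval (x t) (∑ j, pderiv j (p * X i) * f j) =
        eval (x t) (∑ j, pderiv j p * f j) * x t i + eval (x t) p * evalVF f (x t) i := by
      have hpoly : ∑ j, pderiv j (p * X i) * f j =
          (∑ j, pderiv j p * f j) * X i + p * f i := by
        simp only [Derivation.leibniz, pderiv_X, smul_eq_mul, add_mul, Finset.sum_add_distrib]
        rw [add_comm]
        congr 1
        · rw [Finset.sum_mul]
          exact Finset.sum_congr rfl fun j _ => by ring
        · rw [Finset.sum_eq_single i]
          · simp
          · intro j _ hj
            simp [hj.symm]
          · simp
      rw [hpoly]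
      simp [evalVF]
    rw [key]
    simp only [map_mul, eval_X]
    exact hmul

/-- A smooth function whose first non-zero right derivative is positive is positive just to the
right. -/
theorem eventually_pos_of_first_nonzero_deriv_pos {t : ℝ} (ht : 0 ≤ t) (k : ℕ) (g : ℕ → ℝ → ℝ)
    (hg : ∀ j, ∀ s, 0 ≤ s → HasDerivWithinAt (g j) (g (j + 1) s) (Ici 0) s)
    (hzero : ∀ j < k, g j t = 0) (hpos : 0 < g k t) :
    ∀ᶠ s in nhdsWithin t (Ioi t), 0 < g 0 s := by
  induction k generalizing g with
  | zero =>
    have hcont : ContinuousWithinAt (g 0) (Ioi t) t :=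
      (hg 0 t ht).continuousWithinAt.mono fun s hs => ht.trans (le_of_lt hs)
    exact hcont.eventually (lt_mem_nhds hpos)
  | succ k ih =>
    have h1 : ∀ᶠ s in nhdsWithin t (Ioi t), 0 < g 1 s :=
      ih (fun j => g (j + 1)) (fun j => hg (j + 1)) (fun j hj => hzero (j + 1) (by lia)) hpos
    obtain ⟨u, hu, hsub⟩ := (mem_nhdsGT_iff_exists_Ioo_subset).1 h1
    filter_upwards [Ioo_mem_nhdsGT hu] with s hs
    have hmono : StrictMonoOn (g 0) (Icc t s) := by
      refine strictMonoOn_of_deriv_pos (convex_Icc t s) ?_ ?_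
      · intro r hr
        exact (hg 0 r (ht.trans hr.1)).continuousWithinAt.mono fun y hy => ht.trans hy.1
      · intro r hr
        rw [interior_Icc] at hr
        have hr0 : 0 < r := ht.trans_lt hr.1
        rw [((hg 0 r hr0.le).hasDerivAt (Ici_mem_nhds hr0)).deriv]
        exact hsub ⟨hr.1, hr.2.trans hs.2⟩
    have := hmono (left_mem_Icc.2 hs.1.le) (right_mem_Icc.2 hs.1.le) hs.1
    rwa [hzero 0 k.succ_pos] at this

/-- By Noetherianity, some Lie derivative is a polynomial combination of the preceding ones. -/
theorem exists_lieDeriv_eq_sum {n : ℕ} (f : Fin n → MvPolynomial (Fin n) ℝ)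
    (p : MvPolynomial (Fin n) ℝ) :
    ∃ (N : ℕ) (c : Fin (N + 1) → MvPolynomial (Fin n) ℝ),
      lieDeriv f p (N + 1) = ∑ i, c i * lieDeriv f p i := by
  let I : ℕ →o Ideal (MvPolynomial (Fin n) ℝ) :=
    { toFun := fun m => Ideal.span (range fun i : Fin (m + 1) => lieDeriv f p i)
      monotone' := fun a b hab => Ideal.span_mono <| by
        rintro _ ⟨i, rfl⟩
        exact ⟨⟨i, by lia⟩, rfl⟩ }
  obtain ⟨N, hN⟩ := monotone_stabilizes_iff_noetherian.2
    (inferInstance : IsNoetherian (MvPolynomial (Fin n) ℝ) (MvPolynomial (Fin n) ℝ)) I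
  have hmem : lieDeriv f p (N + 1) ∈ I N := by
    rw [hN (N + 1) N.le_succ]
    exact Ideal.subset_span ⟨Fin.last (N + 1), rfl⟩
  obtain ⟨c, hc⟩ := Ideal.mem_span_range_iff_exists_fun.1 hmem
  exact ⟨N, c, hc.symm⟩

/-- If all Lie derivatives of `p` vanish at a point of a solution, then `p` vanishes on the
solution from there on. -/
theorem IsSolutionOn.eval_eq_zero_of_lieDeriv_eq_zero {n : ℕ}
    {f : Fin n → MvPolynomial (Fin n) ℝ} {p : MvPolynomial (Fin n) ℝ} {x : ℝ → (Fin n → ℝ)}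
    (hx : IsSolutionOn (evalVF f) x) {t : ℝ} (ht : 0 ≤ t)
    (hzero : ∀ k, eval (x t) (lieDeriv f p k) = 0) {s : ℝ} (hs : t ≤ s) :
    eval (x s) p = 0 := by
  obtain ⟨N, c, hc⟩ := exists_lieDeriv_eq_sum f p
  have hcont (q : MvPolynomial (Fin n) ℝ) : ContinuousOn (fun r => eval (x r) q) (Icc t s) :=
    fun r hr => (hx.hasDerivWithinAt_eval q (ht.trans hr.1)).continuousWithinAt.mono
      fun y hy => ht.trans hy.1
  obtain ⟨K, hK⟩ := isCompact_Icc.exists_bound_of_continuousOn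
    (f := fun r => ∑ i, |eval (x r) (c i)|)
    (continuousOn_finsetSum _ fun i _ => (hcont (c i)).abs)
  let G : ℝ → Fin (N + 1) → ℝ := fun r i => eval (x r) (lieDeriv f p i)
  let G' : ℝ → Fin (N + 1) → ℝ := fun r i => eval (x r) (lieDeriv f p (i + 1))
  have hG : ∀ r ∈ Icc t s, ‖G r‖ ≤ gronwallBound 0 (max 1 K) 0 (r - t) := by
    refine norm_le_gronwallBound_of_norm_deriv_right_le (f' := G') ?_ ?_ ?_ ?_
    · exact continuousOn_pi.2 fun i => hcont _
    · intro r hr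
      refine hasDerivWithinAt_pi.2 fun i => ?_
      exact (hx.hasDerivWithinAt_eval (lieDeriv f p i) (ht.trans hr.1)).mono
        (Ici_subset_Ici.2 (ht.trans hr.1))
    · have : G t = 0 := funext fun i => hzero i
      simp [this]
    · intro r hr
      rw [add_zero]
      refine (pi_norm_le_iff_of_nonneg (by positivity)).2 fun i => ?_
      rcases Nat.lt_or_ge (i + 1 : ℕ) (N + 1) with hi | hi
      · calc ‖G' r i‖ = ‖G r ⟨i + 1, hi⟩‖ := rfl
          _ ≤ ‖G r‖ := norm_le_pi_norm (G r) _
          _ ≤ max 1 K * ‖G r‖ := le_mul_of_one_le_left (norm_nonneg _) (le_max_left _ _)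
      · have hiN : (i : ℕ) = N := by lia
        calc ‖G' r i‖ = ‖∑ j, eval (x r) (c j) * G r j‖ := by
              simp [G', G, hiN, hc]
          _ ≤ ∑ j, ‖eval (x r) (c j) * G r j‖ := norm_sum_le _ _
          _ ≤ ∑ j, |eval (x r) (c j)| * ‖G r‖ := by
              refine Finset.sum_le_sum fun j _ => ?_
              rw [norm_mul, Real.norm_eq_abs]
              gcongr
              exact norm_le_pi_norm (G r) j
          _ = (∑ j, |eval (x r) (c j)|) * ‖G r‖ := (Finset.sum_mul ..).symm
          _ ≤ max 1 K * ‖G r‖ := by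
              gcongr
              exact (le_abs_self _).trans
                ((hK r (Ico_subset_Icc_self hr)).trans (le_max_right _ _))
  have h0 := hG s (right_mem_Icc.2 hs)
  rw [gronwallBound_ε0_δ0] at h0
  exact congrFun (norm_le_zero_iff.1 h0) 0

/-- **Soundness direction of Theorem 2.** If at every point of the boundary
`p = 0` inside the domain `h > 0`, either all higher-order Lie derivatives of
`p` along `f` vanish, or the first non-vanishing one is positive, then
`{p ≥ 0}` is a continuous invariant of `({h > 0}, f)`. -/
theorem ci_criterion_soundness {n : ℕ} (f : Fin n → MvPolynomial (Fin n) ℝ)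
    (p h : MvPolynomial (Fin n) ℝ)
    (hflow : CompleteFlow (evalVF f))
    (hcond : ∀ x : Fin n → ℝ, eval x p = 0 → 0 < eval x h →
      (∀ k : ℕ, 1 ≤ k → eval x (lieDeriv f p k) = 0) ∨
      (∃ k : ℕ, 1 ≤ k ∧ (∀ j : ℕ, 1 ≤ j → j < k → eval x (lieDeriv f p j) = 0) ∧
        eval x (lieDeriv f p k) ≠ 0 ∧ 0 < eval x (lieDeriv f p k))) :
    IsCI {x | 0 < eval x h} {x | 0 ≤ eval x p} (evalVF f) := by
  intro x hx h0 T _ hD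
  have hderiv (q : MvPolynomial (Fin n) ℝ) (t : ℝ) (ht : 0 ≤ t) :=
    hx.hasDerivWithinAt_eval q ht
  have hclosed : IsClosed ({t | 0 ≤ eval (x t) p} ∩ Icc 0 T) := by
    have hcont : ContinuousOn (fun t => eval (x t) p) (Icc 0 T) := fun t ht =>
      (hderiv p t ht.1).continuousWithinAt.mono fun s hs => hs.1
    rw [inter_comm]
    exact hcont.preimage_isClosed_of_isClosed isClosed_Icc isClosed_Ici
  refine hclosed.Icc_subset_of_forall_mem_nhdsWithin h0.1 ?_
  rintro t ⟨hpt, ht0, htT⟩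
  rcases (show 0 ≤ eval (x t) p from hpt).eq_or_lt with hp | hp
  · rcases hcond (x t) hp.symm (hD t ⟨ht0, htT.le⟩) with hall | ⟨k, hk, hzero, -, hpos⟩
    · filter_upwards [self_mem_nhdsWithin] with s hs
      refine (hx.eval_eq_zero_of_lieDeriv_eq_zero ht0 (fun k => ?_) (le_of_lt hs)).ge
      rcases k.eq_zero_or_pos with rfl | hk
      · exact hp.symm
      · exact hall k hk
    · refine (eventually_pos_of_first_nonzero_deriv_pos ht0 k
        (fun j s => eval (x s) (lieDeriv f p j)) (fun j => hderiv _) (fun j hj => ?_) hpos).mono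
        fun s hs => hs.le
      rcases j.eq_zero_or_pos with rfl | hj0
      · exact hp.symm
      · exact hzero j hj0 hj
  · have hcont : ContinuousWithinAt (fun s => eval (x s) p) (Ioi t) t :=
      (hderiv p t ht0).continuousWithinAt.mono fun s hs => ht0.trans (le_of_lt hs)
    exact (hcont.eventually (lt_mem_nhds hp)).mono fun s hs => hs.le
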